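/- arXiv:1610.07998 — 6 statements merged into one kernel-verified Lean document; each statement's English description precedes it below -/
import Mathlib

section
/- Let ψ : ℝⁿ → ℝ be differentiable and strictly convex, and let u(x) := sup_{ξ ∈ ℝⁿ} ( ⟨x, ξ⟩ − ψ(ξ) ) be its Legendre transform. Fix ξ₀ ∈ ℝⁿ and set x₀ := ∇ψ(ξ₀). Then: (i) the supremum defining u(x₀) is attained at ξ = ξ₀ and at no other point, so u(x₀) = ⟨x₀, ξ₀⟩ − ψ(ξ₀); (ii) the range of ∇ψ is open, u is finite on it, and u is differentiable at x₀ with ∇u(x₀) = ξ₀; in other words, ∇u inverts ∇ψ at corresponding points. -/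
open Set Filter Topology

section LegendreDual

variable {E : Type*} [NormedAddCommGroup E] [NormedSpace ℝ E] {ψ : E → ℝ}

/-- A strictly convex function lies strictly above its tangent hyperplanes. -/
lemma StrictConvexOn.fderiv_sub_lt (hconv : StrictConvexOn ℝ univ ψ) (hψ : Differentiable ℝ ψ)
    {ξ₀ ξ : E} (hne : ξ ≠ ξ₀) :
    fderiv ℝ ψ ξ₀ ξ - ψ ξ < fderiv ℝ ψ ξ₀ ξ₀ - ψ ξ₀ := by
  have hline : StrictConvexOn ℝ univ (fun t : ℝ => ψ (AffineMap.lineMap ξ₀ ξ t)) := by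
    refine ⟨convex_univ, fun s _ t _ hst a b ha hb hab => ?_⟩
    have h := hconv.2 (mem_univ (AffineMap.lineMap ξ₀ ξ s))
      (mem_univ (AffineMap.lineMap ξ₀ ξ t))
      ((AffineMap.lineMap_injective ℝ hne.symm).ne hst) ha hb hab
    rwa [← Convex.combo_affine_apply hab] at h
  have hderiv : HasDerivAt (fun t : ℝ => ψ (AffineMap.lineMap ξ₀ ξ t))
      (fderiv ℝ ψ ξ₀ (ξ - ξ₀)) 0 := by
    have h := (hψ (AffineMap.lineMap ξ₀ ξ (0 : ℝ))).hasFDerivAt.comp_hasDerivAt (0 : ℝ)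
      (AffineMap.hasDerivAt_lineMap (a := ξ₀) (b := ξ))
    simpa [Function.comp_def] using h
  have h := hline.lt_slope_of_hasDerivAt (mem_univ 0) (mem_univ 1) one_pos hderiv
  simp only [slope_def_field, AffineMap.lineMap_apply_one, AffineMap.lineMap_apply_zero, sub_zero,
    div_one, map_sub] at h
  linarith

lemma StrictConvexOn.fderiv_sub_le (hconv : StrictConvexOn ℝ univ ψ) (hψ : Differentiable ℝ ψ)
    (ξ₀ ξ : E) : fderiv ℝ ψ ξ₀ ξ - ψ ξ ≤ fderiv ℝ ψ ξ₀ ξ₀ - ψ ξ₀ := by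
  rcases eq_or_ne ξ ξ₀ with rfl | hne
  · rfl
  · exact (hconv.fderiv_sub_lt hψ hne).le

lemma StrictConvexOn.bddAbove_range_fderiv_sub (hconv : StrictConvexOn ℝ univ ψ)
    (hψ : Differentiable ℝ ψ) (ξ₀ : E) : BddAbove (range fun ξ => fderiv ℝ ψ ξ₀ ξ - ψ ξ) :=
  ⟨_, forall_mem_range.2 (hconv.fderiv_sub_le hψ ξ₀)⟩

lemma StrictConvexOn.iSup_fderiv_sub (hconv : StrictConvexOn ℝ univ ψ) (hψ : Differentiable ℝ ψ)
    (ξ₀ : E) : ⨆ ξ, (fderiv ℝ ψ ξ₀ ξ - ψ ξ) = fderiv ℝ ψ ξ₀ ξ₀ - ψ ξ₀ :=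
  le_antisymm (ciSup_le (hconv.fderiv_sub_le hψ ξ₀))
    (le_ciSup (hconv.bddAbove_range_fderiv_sub hψ ξ₀) ξ₀)

variable [FiniteDimensional ℝ E]

/-- Away from the point of tangency, the gap between a strictly convex function and its tangent
hyperplane grows at least linearly. -/
lemma StrictConvexOn.exists_pos_mul_norm_le (hconv : StrictConvexOn ℝ univ ψ)
    (hψ : Differentiable ℝ ψ) (ξ₀ : E) {ε : ℝ} (hε : 0 < ε) :
    ∃ m > 0, ∀ ξ, ε ≤ ‖ξ - ξ₀‖ → m * ‖ξ - ξ₀‖ ≤ ψ ξ - ψ ξ₀ - fderiv ℝ ψ ξ₀ (ξ - ξ₀) := by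
  have : ProperSpace E := FiniteDimensional.proper ℝ E
  have hsphere : ∃ m > 0, ∀ η ∈ Metric.sphere ξ₀ ε,
      m ≤ ψ η - ψ ξ₀ - fderiv ℝ ψ ξ₀ (η - ξ₀) := by
    rcases (Metric.sphere ξ₀ ε).eq_empty_or_nonempty with hempty | hnonempty
    · exact ⟨1, one_pos, by simp [hempty]⟩
    · have hcont : Continuous fun η => ψ η - ψ ξ₀ - fderiv ℝ ψ ξ₀ (η - ξ₀) := by
        have := hψ.continuous
        fun_prop
      obtain ⟨η, hη, hmin⟩ :=
        (isCompact_sphere ξ₀ ε).exists_isMinOn hnonempty hcont.continuousOn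
      refine ⟨_, ?_, fun ζ hζ => hmin hζ⟩
      have hlt := hconv.fderiv_sub_lt hψ (Metric.ne_of_mem_sphere hη hε.ne')
      simp only [map_sub]
      linarith
  obtain ⟨m, hm, hle⟩ := hsphere
  refine ⟨m / ε, by positivity, fun ξ hξ => ?_⟩
  have hr : 0 < ‖ξ - ξ₀‖ := hε.trans_le hξ
  set t := ε / ‖ξ - ξ₀‖ with ht
  have ht0 : 0 < t := by positivity
  have ht1 : t ≤ 1 := (div_le_one hr).2 hξ
  have hcombo : (1 - t) • ξ₀ + t • ξ - ξ₀ = t • (ξ - ξ₀) := by module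
  have hmem : (1 - t) • ξ₀ + t • ξ ∈ Metric.sphere ξ₀ ε := by
    rw [mem_sphere_iff_norm, hcombo, norm_smul, Real.norm_of_nonneg ht0.le, ht,
      div_mul_cancel₀ _ hr.ne']
  have hgap := hle _ hmem
  have hsec := hconv.convexOn.2 (mem_univ ξ₀) (mem_univ ξ) (sub_nonneg.2 ht1) ht0.le
    (sub_add_cancel 1 t)
  rw [hcombo, map_smul] at hgap
  simp only [smul_eq_mul] at hgap hsec
  have hmt : m ≤ t * (ψ ξ - ψ ξ₀ - fderiv ℝ ψ ξ₀ (ξ - ξ₀)) := by linarith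
  calc m / ε * ‖ξ - ξ₀‖ = m / t := by rw [ht]; field_simp
    _ ≤ _ := (div_le_iff₀' ht0).2 hmt

/-- Covectors near `fderiv ℝ ψ ξ₀` are derivatives of `ψ` at points near `ξ₀`. -/
lemma StrictConvexOn.eventually_exists_fderiv_eq (hconv : StrictConvexOn ℝ univ ψ)
    (hψ : Differentiable ℝ ψ) (ξ₀ : E) {ε : ℝ} (hε : 0 < ε) :
    ∀ᶠ f in 𝓝 (fderiv ℝ ψ ξ₀), ∃ ξ, ‖ξ - ξ₀‖ ≤ ε ∧ fderiv ℝ ψ ξ = f := by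
  have : ProperSpace E := FiniteDimensional.proper ℝ E
  obtain ⟨m, hm, hgrow⟩ := hconv.exists_pos_mul_norm_le hψ ξ₀ hε
  filter_upwards [Metric.ball_mem_nhds _ hm] with f hf
  rw [mem_ball_iff_norm] at hf
  have hcont : Continuous fun ξ => f ξ - ψ ξ := f.continuous.sub hψ.continuous
  obtain ⟨η, hη, hmax⟩ := (isCompact_closedBall ξ₀ ε).exists_isMaxOn
    ⟨ξ₀, Metric.mem_closedBall_self hε.le⟩ hcont.continuousOn
  refine ⟨η, mem_closedBall_iff_norm.1 hη, ?_⟩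
  have hglobal : ∀ ξ, f ξ - ψ ξ ≤ f η - ψ η := by
    intro ξ
    rcases le_total ‖ξ - ξ₀‖ ε with hξ | hξ
    · exact hmax (mem_closedBall_iff_norm.2 hξ)
    · refine le_trans ?_ (hmax (Metric.mem_closedBall_self hε.le))
      have hbound : (f - fderiv ℝ ψ ξ₀) (ξ - ξ₀) ≤ m * ‖ξ - ξ₀‖ :=
        (le_abs_self _).trans <| ContinuousLinearMap.le_of_opNorm_le _ hf.le _
      have h := hgrow ξ hξ
      simp only [sub_apply, map_sub] at hbound h
      linarith
  have hzero := IsLocalMax.hasFDerivAt_eq_zero (Eventually.of_forall hglobal)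
    (f.hasFDerivAt.sub (hψ η).hasFDerivAt)
  exact (sub_eq_zero.1 hzero).symm

lemma StrictConvexOn.isOpen_range_fderiv (hconv : StrictConvexOn ℝ univ ψ)
    (hψ : Differentiable ℝ ψ) : IsOpen (range (fderiv ℝ ψ)) := by
  rw [isOpen_iff_mem_nhds]
  rintro _ ⟨ξ₀, rfl⟩
  filter_upwards [hconv.eventually_exists_fderiv_eq hψ ξ₀ one_pos] with f ⟨ξ, _, hξ⟩
  exact ⟨ξ, hξ⟩

/-- The Legendre transform is differentiable at `fderiv ℝ ψ ξ₀`, and its derivative there is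
evaluation at `ξ₀`. -/
lemma StrictConvexOn.hasFDerivAt_legendre (hconv : StrictConvexOn ℝ univ ψ)
    (hψ : Differentiable ℝ ψ) (ξ₀ : E) :
    HasFDerivAt (fun f : E →L[ℝ] ℝ => ⨆ ξ, (f ξ - ψ ξ)) (ContinuousLinearMap.apply ℝ ℝ ξ₀)
      (fderiv ℝ ψ ξ₀) := by
  rw [hasFDerivAt_iff_isLittleO, Asymptotics.isLittleO_iff]
  intro ε hε
  filter_upwards [hconv.eventually_exists_fderiv_eq hψ ξ₀ hε] with f ⟨ξ, hξ, hf⟩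
  have hlower := hconv.fderiv_sub_le hψ ξ ξ₀
  have hupper := hconv.fderiv_sub_le hψ ξ₀ ξ
  have hsup := hconv.iSup_fderiv_sub hψ ξ
  rw [hf] at hlower hsup
  have hbound : (f - fderiv ℝ ψ ξ₀) (ξ - ξ₀) ≤ ε * ‖f - fderiv ℝ ψ ξ₀‖ :=
    (le_abs_self _).trans <| ((f - fderiv ℝ ψ ξ₀).le_opNorm_of_le hξ).trans_eq (mul_comm _ _)
  rw [hsup, hconv.iSup_fderiv_sub hψ, Real.norm_eq_abs, abs_le]
  have hpos : 0 ≤ ε * ‖f - fderiv ℝ ψ ξ₀‖ := by positivity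
  simp only [ContinuousLinearMap.apply_apply, sub_apply, map_sub] at hbound ⊢
  constructor <;> linarith

end LegendreDual

/-- The continuous linear functional `y ↦ ∑ i, x i * y i`, depending linearly on `x`. -/
noncomputable def sumMulCLM (n : ℕ) : (Fin n → ℝ) →L[ℝ] (Fin n → ℝ) →L[ℝ] ℝ :=
  ∑ i, (ContinuousLinearMap.proj (R := ℝ) (φ := fun _ : Fin n => ℝ) i).smulRight
    (ContinuousLinearMap.proj (R := ℝ) (φ := fun _ : Fin n => ℝ) i)

lemma sumMulCLM_apply {n : ℕ} (x y : Fin n → ℝ) : sumMulCLM n x y = ∑ i, x i * y i := by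
  simp [sumMulCLM]

lemma sumMulCLM_apply_single {n : ℕ} (f : (Fin n → ℝ) →L[ℝ] ℝ) :
    sumMulCLM n (fun i => f (Pi.single i 1)) = f := by
  rw [← ContinuousLinearMap.coe_inj]
  ext i
  simp [sumMulCLM_apply, Pi.single_apply]

lemma sumMulCLM_injective (n : ℕ) : Function.Injective (sumMulCLM n) := by
  intro x y h
  ext i
  simpa [sumMulCLM_apply, Pi.single_apply] using DFunLike.congr_fun h (Pi.single i 1)

/-- Legendre duality underlying the toric description of Kähler metrics:
for a differentiable strictly convex `ψ : ℝⁿ → ℝ` with Legendre transform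
`u(x) = sup_ξ (⟨x,ξ⟩ − ψ(ξ))` and `x₀ = ∇ψ(ξ₀)`:
(i) the supremum defining `u(x₀)` is attained exactly at `ξ₀`, so
`u(x₀) = ⟨x₀,ξ₀⟩ − ψ(ξ₀)`;
(ii) the range of `∇ψ` is open, `u` is finite on it, and `u` is differentiable
at `x₀` with `∇u(x₀) = ξ₀`. -/
theorem legendre_transform_gradient_duality
    {n : ℕ} (ψ : (Fin n → ℝ) → ℝ)
    (hψ : Differentiable ℝ ψ) (hconv : StrictConvexOn ℝ Set.univ ψ)
    (u : (Fin n → ℝ) → ℝ)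
    (hu : ∀ x, u x = ⨆ ξ : Fin n → ℝ, (∑ i, x i * ξ i - ψ ξ))
    (gradψ : (Fin n → ℝ) → (Fin n → ℝ))
    (hgrad : ∀ ξ i, gradψ ξ i = fderiv ℝ ψ ξ (Pi.single i 1))
    (ξ₀ : Fin n → ℝ) (x₀ : Fin n → ℝ) (hx₀ : x₀ = gradψ ξ₀) :
    -- (i) unique attainment of the supremum at ξ₀
    (∀ ξ : Fin n → ℝ, ξ ≠ ξ₀ →
        ∑ i, x₀ i * ξ i - ψ ξ < ∑ i, x₀ i * ξ₀ i - ψ ξ₀) ∧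
    u x₀ = ∑ i, x₀ i * ξ₀ i - ψ ξ₀ ∧
    -- (ii) the range of ∇ψ is open, u is finite on it, and ∇u(x₀) = ξ₀
    IsOpen (Set.range gradψ) ∧
    (∀ x ∈ Set.range gradψ,
        BddAbove (Set.range fun ξ : Fin n → ℝ => ∑ i, x i * ξ i - ψ ξ)) ∧
    DifferentiableAt ℝ u x₀ ∧
    (∀ y : Fin n → ℝ, fderiv ℝ u x₀ y = ∑ i, ξ₀ i * y i) := by
  have hΦ : ∀ ξ, sumMulCLM n (gradψ ξ) = fderiv ℝ ψ ξ := fun ξ => by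
    rw [funext (hgrad ξ), sumMulCLM_apply_single]
  have hu' : u = (fun f : (Fin n → ℝ) →L[ℝ] ℝ => ⨆ ξ, (f ξ - ψ ξ)) ∘ sumMulCLM n := by
    ext x
    simp only [hu, Function.comp_apply, sumMulCLM_apply]
  have hderiv : HasFDerivAt u ((ContinuousLinearMap.apply ℝ ℝ ξ₀).comp (sumMulCLM n)) x₀ := by
    have h := hconv.hasFDerivAt_legendre hψ ξ₀
    rw [← hΦ, ← hx₀] at h
    rw [hu']
    exact h.comp x₀ (sumMulCLM n).hasFDerivAt
  have hrange : range gradψ = sumMulCLM n ⁻¹' range (fderiv ℝ ψ) := by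
    ext x
    simp only [mem_range, mem_preimage, ← hΦ, (sumMulCLM_injective n).eq_iff]
  refine ⟨fun ξ hξ => ?_, ?_, ?_, ?_, hderiv.differentiableAt, fun y => ?_⟩
  · simpa only [← hΦ, ← hx₀, sumMulCLM_apply] using hconv.fderiv_sub_lt hψ hξ
  · rw [hu]
    simpa only [← hΦ, ← hx₀, sumMulCLM_apply] using hconv.iSup_fderiv_sub hψ ξ₀
  · rw [hrange]
    exact (hconv.isOpen_range_fderiv hψ).preimage (sumMulCLM n).continuous
  · rintro _ ⟨ξ, rfl⟩
    simpa only [← hΦ, sumMulCLM_apply] using hconv.bddAbove_range_fderiv_sub hψ ξ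
  · rw [hderiv.fderiv]
    simp [sumMulCLM_apply, mul_comm]
end

section
/- Let V and W be nonzero finite-dimensional normed complex vector spaces, let ρ_V : GL(N,ℂ) → GL(V) and ρ_W : GL(N,ℂ) → GL(W) be group homomorphisms into the groups of invertible linear maps, and let λ : ℂ* → GL(N,ℂ) be a group homomorphism (a one-parameter subgroup). Let v ∈ V be nonzero with a decomposition v = Σ_{i=1}^{m} v_i into nonzero vectors satisfying ρ_V(λ(τ)) v_i = τ^{a_i} v_i for all τ ∈ ℂ*, where a_1,…,a_m are distinct integers; similarly let w ∈ W be nonzero with w = Σ_{j=1}^{p} w_j, ρ_W(λ(τ)) w_j = τ^{b_j} w_j, with distinct integers b_j. Fix real numbers α, β and define f(g) := α·log‖ρ_V(g)v‖ − β·log‖ρ_W(g)w‖ for g ∈ GL(N,ℂ). Then, setting f^{NA}(λ) := −α·min_i a_i + β·min_j b_j, there exists a constant C such that | f(λ(τ)) − f^{NA}(λ)·log|τ|⁻¹ | ≤ C for all τ ∈ ℂ with 0 < |τ| ≤ 1. -/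
/-- For linearly independent vectors, the norm of a linear combination is comparable to the sup
norm of the coefficients; logarithmic form. -/
theorem LinearIndependent.exists_abs_log_norm_sum_sub_log_norm_le
    {𝕜 ι E : Type*} [NontriviallyNormedField 𝕜] [CompleteSpace 𝕜] [Fintype ι]
    [NormedAddCommGroup E] [NormedSpace 𝕜 E] {v : ι → E} (hv : LinearIndependent 𝕜 v) :
    ∃ C : ℝ, ∀ z : ι → 𝕜, z ≠ 0 → |Real.log ‖∑ i, z i • v i‖ - Real.log ‖z‖| ≤ C := by
  have hker : LinearMap.ker (Fintype.linearCombination 𝕜 v) = ⊥ :=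
    LinearMap.ker_eq_bot.mpr hv.fintypeLinearCombination_injective
  obtain ⟨K, hK, hanti⟩ := LinearMap.exists_antilipschitzWith _ hker
  set F : (ι → 𝕜) →L[𝕜] E := LinearMap.toContinuousLinearMap (Fintype.linearCombination 𝕜 v)
  have hF : ∀ z, F z = ∑ i, z i • v i := fun z ↦ Fintype.linearCombination_apply 𝕜 v z
  refine ⟨max (Real.log (‖F‖ + 1)) (Real.log K), fun z hz ↦ ?_⟩
  have hK' : (0 : ℝ) < K := by exact_mod_cast hK
  have hz' : 0 < ‖z‖ := norm_pos_iff.mpr hz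
  have hlow : ‖z‖ ≤ K * ‖F z‖ := hanti.le_mul_norm (map_zero _) z
  have hFz : 0 < ‖F z‖ := pos_of_mul_pos_right (hz'.trans_le hlow) hK'.le
  have hupp : ‖F z‖ ≤ (‖F‖ + 1) * ‖z‖ :=
    (F.le_opNorm z).trans (by gcongr; linarith)
  have h₁ := Real.log_le_log hz' hlow
  have h₂ := Real.log_le_log hFz hupp
  rw [Real.log_mul hK'.ne' hFz.ne'] at h₁
  rw [Real.log_mul (by positivity) hz'.ne'] at h₂
  rw [← hF, abs_le]
  constructor
  · linarith [le_max_right (Real.log (‖F‖ + 1)) (Real.log K)]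
  · linarith [le_max_left (Real.log (‖F‖ + 1)) (Real.log K)]

theorem norm_zpow_family_eq_zpow_inf' {𝕜 ι : Type*} [NormedField 𝕜] [Fintype ι]
    (h : (Finset.univ : Finset ι).Nonempty) (a : ι → ℤ) {t : 𝕜} (ht : t ≠ 0) (ht1 : ‖t‖ ≤ 1) :
    ‖fun i ↦ t ^ a i‖ = ‖t‖ ^ Finset.univ.inf' h a := by
  have ht0 : 0 < ‖t‖ := norm_pos_iff.mpr ht
  apply le_antisymm
  · refine (pi_norm_le_iff_of_nonneg (by positivity)).mpr fun i ↦ ?_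
    rw [norm_zpow]
    exact zpow_le_zpow_right_of_le_one₀ ht0 ht1 (Finset.inf'_le a (Finset.mem_univ i))
  · obtain ⟨i, -, hi⟩ := Finset.exists_mem_eq_inf' h a
    rw [hi, ← norm_zpow]
    exact norm_le_pi_norm (fun i ↦ t ^ a i) i

/-- Along a family of endomorphisms acting on nonzero `v i` through distinct weights `a i`,
`log ‖T τ (∑ i, v i)‖` is asymptotic to `(min a) * log ‖τ‖` up to a bounded error. -/
theorem exists_abs_log_norm_weight_sum_sub_le
    {ι E : Type*} [Fintype ι] [NormedAddCommGroup E] [NormedSpace ℂ E]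
    (h : (Finset.univ : Finset ι).Nonempty) (T : ℂˣ → E →ₗ[ℂ] E) {v : ι → E}
    (hv : ∀ i, v i ≠ 0) {a : ι → ℤ} (ha : Function.Injective a)
    (hT : ∀ (τ : ℂˣ) (i : ι), T τ (v i) = (τ : ℂ) ^ a i • v i) :
    ∃ C : ℝ, ∀ τ : ℂˣ, ‖(τ : ℂ)‖ ≤ 1 →
      |Real.log ‖T τ (∑ i, v i)‖
        - ((Finset.univ.inf' h a : ℤ) : ℝ) * Real.log ‖(τ : ℂ)‖| ≤ C := by
  have hinj : Function.Injective fun i ↦ (2 : ℂ) ^ a i := by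
    intro i j hij
    apply ha
    have := congrArg norm hij
    simp only [norm_zpow, Complex.norm_ofNat] at this
    exact zpow_right_injective₀ (by norm_num) (by norm_num) this
  have hlin : LinearIndependent ℂ v :=
    Module.End.eigenvectors_linearIndependent' (T (Units.mk0 2 two_ne_zero)) _ hinj v fun i ↦
      Module.End.hasEigenvector_iff.mpr
        ⟨Module.End.mem_eigenspace_iff.mpr (hT (Units.mk0 2 two_ne_zero) i), hv i⟩
  obtain ⟨C, hC⟩ := hlin.exists_abs_log_norm_sum_sub_log_norm_le
  refine ⟨C, fun τ hτ ↦ ?_⟩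
  obtain ⟨i₀, -⟩ := h
  have hz : (fun i ↦ (τ : ℂ) ^ a i) ≠ 0 := fun h0 ↦
    zpow_ne_zero (a i₀) τ.ne_zero (congrFun h0 i₀)
  have := hC _ hz
  rwa [norm_zpow_family_eq_zpow_inf' ⟨i₀, Finset.mem_univ i₀⟩ a τ.ne_zero hτ, Real.log_zpow,
    ← Finset.sum_congr rfl fun i _ ↦ hT τ i, ← map_sum] at this

/-- Theorem 3.2(i) of the paper (Boucksom–Hisamoto–Jonsson), concrete form:
a function on `GL(N, ℂ)` with log-norm singularities,
`f(g) = α log‖ρ_V(g)v‖ − β log‖ρ_W(g)w‖`, restricted to a one-parameter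
subgroup `λ`, satisfies `f(λ(τ)) = f^{NA}(λ)·log|τ|⁻¹ + O(1)` for `0 < |τ| ≤ 1`,
where `f^{NA}(λ) = −α·minᵢ aᵢ + β·minⱼ bⱼ` is computed from the weight
decompositions `v = Σ vᵢ`, `ρ_V(λ(τ))vᵢ = τ^{aᵢ}vᵢ` and `w = Σ wⱼ`,
`ρ_W(λ(τ))wⱼ = τ^{bⱼ}wⱼ`. -/
theorem one_parameter_subgroup_log_norm_slope
    {V W : Type*}
    [NormedAddCommGroup V] [NormedSpace ℂ V] [FiniteDimensional ℂ V] [Nontrivial V]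
    [NormedAddCommGroup W] [NormedSpace ℂ W] [FiniteDimensional ℂ W] [Nontrivial W]
    (N : ℕ)
    (ρV : GL (Fin N) ℂ →* (V →ₗ[ℂ] V)ˣ)
    (ρW : GL (Fin N) ℂ →* (W →ₗ[ℂ] W)ˣ)
    (lam : ℂˣ →* GL (Fin N) ℂ)
    {m p : ℕ} (hm : 0 < m) (hp : 0 < p)
    (v : Fin m → V) (hv0 : ∀ i, v i ≠ 0) (hvsum : (∑ i, v i) ≠ 0)
    (w : Fin p → W) (hw0 : ∀ j, w j ≠ 0) (hwsum : (∑ j, w j) ≠ 0)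
    (a : Fin m → ℤ) (ha : Function.Injective a)
    (b : Fin p → ℤ) (hb : Function.Injective b)
    (hva : ∀ (τ : ℂˣ) (i : Fin m), (ρV (lam τ)).val (v i) = (τ : ℂ) ^ (a i) • v i)
    (hwb : ∀ (τ : ℂˣ) (j : Fin p), (ρW (lam τ)).val (w j) = (τ : ℂ) ^ (b j) • w j)
    (α β : ℝ) :
    ∃ C : ℝ, ∀ τ : ℂˣ, ‖(τ : ℂ)‖ ≤ 1 →
      |(α * Real.log ‖(ρV (lam τ)).val (∑ i, v i)‖
          - β * Real.log ‖(ρW (lam τ)).val (∑ j, w j)‖)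
        - (-α * ((Finset.univ.inf' (Finset.univ_nonempty_iff.mpr
              (Fin.pos_iff_nonempty.mp hm)) a : ℤ) : ℝ)
           + β * ((Finset.univ.inf' (Finset.univ_nonempty_iff.mpr
              (Fin.pos_iff_nonempty.mp hp)) b : ℤ) : ℝ))
          * Real.log (‖(τ : ℂ)‖⁻¹)| ≤ C := by
  obtain ⟨C, hC⟩ := exists_abs_log_norm_weight_sum_sub_le
    (Finset.univ_nonempty_iff.mpr (Fin.pos_iff_nonempty.mp hm))
    (fun τ ↦ (ρV (lam τ)).val) hv0 ha hva
  obtain ⟨D, hD⟩ := exists_abs_log_norm_weight_sum_sub_le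
    (Finset.univ_nonempty_iff.mpr (Fin.pos_iff_nonempty.mp hp))
    (fun τ ↦ (ρW (lam τ)).val) hw0 hb hwb
  refine ⟨|α| * C + |β| * D, fun τ hτ ↦ ?_⟩
  have h₁ := mul_le_mul_of_nonneg_left (hC τ hτ) (abs_nonneg α)
  have h₂ := mul_le_mul_of_nonneg_left (hD τ hτ) (abs_nonneg β)
  rw [← abs_mul] at h₁ h₂
  refine le_trans (le_of_eq ?_) ((abs_sub _ _).trans (add_le_add h₁ h₂))
  rw [Real.log_inv]
  congr 1
  ring
end

section
/- Let V be a normed complex vector space, let v_1,…,v_m ∈ V be linearly independent (in particular nonzero) vectors, and let λ_1,…,λ_m be distinct integers. Then there exists a constant C such that for every τ ∈ ℂ with 0 < |τ| ≤ 1, | log‖ Σ_{i=1}^{m} τ^{λ_i} v_i ‖ − (min_i λ_i)·log|τ| | ≤ C. -/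
/-- An injective linear map out of a finite-dimensional normed space changes the logarithm of the
norm of nonzero vectors by a bounded amount. -/
theorem LinearMap.exists_abs_log_norm_sub_log_norm_le {𝕜 E F : Type*}
    [NontriviallyNormedField 𝕜] [CompleteSpace 𝕜] [NormedAddCommGroup E] [NormedSpace 𝕜 E]
    [NormedAddCommGroup F] [NormedSpace 𝕜 F] [FiniteDimensional 𝕜 E]
    (f : E →ₗ[𝕜] F) (hf : Function.Injective f) :
    ∃ C : ℝ, ∀ x : E, x ≠ 0 → |Real.log ‖f x‖ - Real.log ‖x‖| ≤ C := by
  obtain ⟨K, hK, hfK⟩ := f.exists_antilipschitzWith (LinearMap.ker_eq_bot.mpr hf)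
  obtain ⟨M, hM, hfM⟩ := f.toContinuousLinearMap.bound
  refine ⟨max (Real.log M) (Real.log K), fun x hx => ?_⟩
  have hx' : 0 < ‖x‖ := norm_pos_iff.mpr hx
  have hfx : 0 < ‖f x‖ := norm_pos_iff.mpr ((map_ne_zero_iff f hf).mpr hx)
  have hupper : ‖f x‖ ≤ M * ‖x‖ := hfM x
  have hlower : ‖x‖ ≤ K * ‖f x‖ := by simpa using hfK.le_mul_dist x 0
  have hlog_upper := Real.log_le_log hfx hupper
  have hlog_lower := Real.log_le_log hx' hlower
  rw [Real.log_mul hM.ne' hx'.ne'] at hlog_upper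
  rw [Real.log_mul (NNReal.coe_pos.mpr hK).ne' hfx.ne'] at hlog_lower
  rw [abs_le']
  exact ⟨le_max_of_le_left (by linarith), le_max_of_le_right (by linarith)⟩

/-- For `0 < ‖τ‖ ≤ 1`, the sup norm of a tuple of integer powers of `τ` is given by the smallest
exponent. -/
theorem pi_norm_zpow_eq_norm_zpow_inf' {𝕜 ι : Type*} [NormedDivisionRing 𝕜] [Fintype ι]
    (h : (Finset.univ : Finset ι).Nonempty) (n : ι → ℤ) {τ : 𝕜} (hτ : τ ≠ 0) (hτ' : ‖τ‖ ≤ 1) :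
    ‖fun i => τ ^ n i‖ = ‖τ‖ ^ Finset.univ.inf' h n := by
  apply le_antisymm
  · refine (pi_norm_le_iff_of_nonneg (by positivity)).mpr fun i => ?_
    rw [norm_zpow]
    exact zpow_le_zpow_right_of_le_one₀ (norm_pos_iff.mpr hτ) hτ'
      (Finset.inf'_le n (Finset.mem_univ i))
  · obtain ⟨i, -, hi⟩ := Finset.exists_mem_eq_inf' h n
    rw [hi, ← norm_zpow]
    exact norm_le_pi_norm (fun i => τ ^ n i) i

/-- Key asymptotic in the proof of Theorem 3.2 of the paper: if `v₁, …, v_m` are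
linearly independent vectors in a normed complex vector space and `λ₁, …, λ_m`
are distinct integers, then `log ‖∑ τ^{λᵢ} vᵢ‖ = (min λᵢ) log |τ| + O(1)` for
`0 < |τ| ≤ 1`. -/
theorem log_norm_sum_zpow_smul_asymptotic
    {V : Type*} [NormedAddCommGroup V] [NormedSpace ℂ V]
    {m : ℕ} (hm : 0 < m) (v : Fin m → V) (hv : LinearIndependent ℂ v)
    (lam : Fin m → ℤ) (hlam : Function.Injective lam) :
    ∃ C : ℝ, ∀ τ : ℂ, τ ≠ 0 → ‖τ‖ ≤ 1 →
      |Real.log ‖∑ i, τ ^ (lam i) • v i‖ -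
        ((Finset.univ.inf' (Finset.univ_nonempty_iff.mpr
          (Fin.pos_iff_nonempty.mp hm)) lam : ℤ) : ℝ) * Real.log ‖τ‖| ≤ C := by
  obtain ⟨C, hC⟩ := (Fintype.linearCombination ℂ v).exists_abs_log_norm_sub_log_norm_le
    hv.fintypeLinearCombination_injective
  refine ⟨C, fun τ hτ hτ' => ?_⟩
  have hne : (fun i => τ ^ lam i) ≠ 0 := fun h =>
    zpow_ne_zero (lam ⟨0, hm⟩) hτ (congrFun h ⟨0, hm⟩)
  have key := hC _ hne
  rwa [pi_norm_zpow_eq_norm_zpow_inf' (Finset.univ_nonempty_iff.mpr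
    (Fin.pos_iff_nonempty.mp hm)) lam hτ hτ', Real.log_zpow,
    Fintype.linearCombination_apply] at key
end

section
/- Let V = ⊕_{χ ∈ F} V_χ and W = ⊕_{χ ∈ G} W_χ be nonzero finite-dimensional normed complex vector spaces with direct sum decompositions indexed by finite sets F, G ⊂ ℤᴺ, where d = (d_1,…,d_N) ∈ (ℂ*)ᴺ acts on V_χ (resp. W_χ) as multiplication by d^χ := Π d_i^{χ_i}. Fix nonzero vectors v ∈ V and w ∈ W, let M_v := {χ ∈ F : v_χ ≠ 0} and M_w := {χ ∈ G : w_χ ≠ 0}, fix reals α, β > 0, and define f(d) := α·log‖d·v‖ − β·log‖d·w‖ for d ∈ (ℂ*)ᴺ. Then f is bounded from below on (ℂ*)ᴺ if and only if for every λ ∈ ℤᴺ one has α·max_{χ ∈ M_v} ⟨χ, λ⟩ ≥ β·max_{χ ∈ M_w} ⟨χ, λ⟩ (equivalently, the slope f^{NA}(λ) := −α·min_{χ ∈ M_v}⟨χ,λ⟩ + β·min_{χ ∈ M_w}⟨χ,λ⟩ is nonnegative for every one-parameter subgroup λ of the torus). -/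
/-- The support function `x ↦ max_{χ ∈ S} ⟨χ, x⟩` of a nonempty finite set of weights. -/
noncomputable def weightSupport {N : ℕ} (S : Finset (Fin N → ℤ)) (hS : S.Nonempty)
    (x : Fin N → ℝ) : ℝ :=
  S.sup' hS fun χ => ∑ i, (χ i : ℝ) * x i

theorem weightSupport_smul {N : ℕ} (S : Finset (Fin N → ℤ)) (hS : S.Nonempty)
    (x : Fin N → ℝ) {t : ℝ} (ht : 0 ≤ t) :
    weightSupport S hS (fun i => t * x i) = t * weightSupport S hS x := by
  unfold weightSupport
  rw [Finset.mul₀_sup' ht]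
  congr 1
  funext χ
  rw [Finset.mul_sum]
  exact Finset.sum_congr rfl fun i _ => by ring

/-- Points at sup-distance at most one have support values at bounded distance. -/
theorem weightSupport_le_add {N : ℕ} (S : Finset (Fin N → ℤ)) (hS : S.Nonempty)
    (x y : Fin N → ℝ) (hxy : ∀ i, |x i - y i| ≤ 1) :
    weightSupport S hS x ≤ weightSupport S hS y + ∑ χ ∈ S, ∑ i, |(χ i : ℝ)| := by
  refine Finset.sup'_le hS _ fun χ hχ => ?_
  have h1 : ∑ i, (χ i : ℝ) * y i ≤ weightSupport S hS y :=
    Finset.le_sup' (fun χ : Fin N → ℤ => ∑ i, (χ i : ℝ) * y i) hχ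
  have h2 : ∑ i, |(χ i : ℝ)| ≤ ∑ χ ∈ S, ∑ i, |(χ i : ℝ)| :=
    Finset.single_le_sum (f := fun χ : Fin N → ℤ => ∑ i, |(χ i : ℝ)|)
      (fun _ _ => Finset.sum_nonneg fun _ _ => abs_nonneg _) hχ
  have h3 : ∑ i, (χ i : ℝ) * x i - ∑ i, (χ i : ℝ) * y i ≤ ∑ i, |(χ i : ℝ)| := by
    rw [← Finset.sum_sub_distrib]
    refine Finset.sum_le_sum fun i _ => ?_
    rw [← mul_sub]
    calc (χ i : ℝ) * (x i - y i) ≤ |(χ i : ℝ) * (x i - y i)| := le_abs_self _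
      _ = |(χ i : ℝ)| * |x i - y i| := abs_mul _ _
      _ ≤ |(χ i : ℝ)| := mul_le_of_le_one_right (abs_nonneg _) (hxy i)
  linarith

/-- The coordinates of a finite linear combination of independent vectors are controlled by
its norm. -/
theorem LinearIndependent.exists_norm_coeff_le {ι V : Type*} [Fintype ι]
    [NormedAddCommGroup V] [NormedSpace ℂ V] {u : ι → V} (hu : LinearIndependent ℂ u) :
    ∃ K : ℝ, 0 < K ∧ ∀ (a : ι → ℂ) (j : ι), ‖a j‖ ≤ K * ‖∑ i, a i • u i‖ := by
  obtain ⟨K, hK, hanti⟩ := LinearMap.exists_antilipschitzWith (Fintype.linearCombination ℂ u)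
    (LinearMap.ker_eq_bot.2 hu.fintypeLinearCombination_injective)
  refine ⟨K, hK, fun a j => (norm_le_pi_norm a j).trans ?_⟩
  simpa [Fintype.linearCombination_apply] using hanti.le_mul_dist a 0

theorem norm_torus_character {N : ℕ} (d : Fin N → ℂˣ) (χ : Fin N → ℤ) :
    ‖∏ i, ((d i : ℂ) ^ (χ i))‖ = Real.exp (∑ i, (χ i : ℝ) * Real.log ‖(d i : ℂ)‖) := by
  rw [norm_prod, Real.exp_sum]
  refine Finset.prod_congr rfl fun i _ => ?_
  rw [norm_zpow, mul_comm, Real.exp_mul, Real.exp_log (norm_pos_iff.2 (d i).ne_zero),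
    Real.rpow_intCast]

/-- Along a torus orbit, the logarithm of the norm is the support function of the weights of the
vector, up to a bounded error. -/
theorem exists_abs_log_norm_torus_sub_weightSupport_le {V : Type*}
    [NormedAddCommGroup V] [NormedSpace ℂ V] {N : ℕ} (F : Finset (Fin N → ℤ))
    (Vsub : (Fin N → ℤ) → Submodule ℂ V) (hVindep : iSupIndep fun χ : F => Vsub χ)
    (vc : (Fin N → ℤ) → V) (hvc : ∀ χ, vc χ ∈ Vsub χ)
    (S : Finset (Fin N → ℤ)) (hSF : ∀ χ, χ ∈ S ↔ χ ∈ F ∧ vc χ ≠ 0) (hS : S.Nonempty) :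
    ∃ B : ℝ, ∀ d : Fin N → ℂˣ,
      |Real.log ‖∑ χ ∈ F, (∏ i, ((d i : ℂ) ^ (χ i))) • vc χ‖
        - weightSupport S hS (fun i => Real.log ‖(d i : ℂ)‖)| ≤ B := by
  have hli : LinearIndependent ℂ fun χ : S => vc χ := by
    have hinj : Function.Injective fun χ : S => (⟨χ, ((hSF χ).1 χ.2).1⟩ : F) := by
      intro a b hab
      exact Subtype.ext (congrArg (fun χ : F => (χ : Fin N → ℤ)) hab)
    exact (hVindep.comp hinj).linearIndependent _ (fun χ => hvc χ) fun χ => ((hSF χ).1 χ.2).2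
  obtain ⟨K, hK, hcoeff⟩ := hli.exists_norm_coeff_le
  have hsum : ∀ a : (Fin N → ℤ) → ℂ, ∑ χ ∈ F, a χ • vc χ = ∑ χ ∈ S, a χ • vc χ := by
    intro a
    refine (Finset.sum_subset (fun χ hχ => ((hSF χ).1 hχ).1) fun χ hF hχ => ?_).symm
    have : vc χ = 0 := by
      by_contra h
      exact hχ ((hSF χ).2 ⟨hF, h⟩)
    rw [this, smul_zero]
  have hT : 0 < ∑ χ ∈ S, ‖vc χ‖ :=
    Finset.sum_pos (fun χ hχ => norm_pos_iff.2 ((hSF χ).1 hχ).2) hS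
  refine ⟨max (Real.log K) (Real.log (∑ χ ∈ S, ‖vc χ‖)), fun d => ?_⟩
  rw [hsum]
  set x : Fin N → ℝ := fun i => Real.log ‖(d i : ℂ)‖ with hx
  set n := ‖∑ χ ∈ S, (∏ i, ((d i : ℂ) ^ (χ i))) • vc χ‖ with hn
  have hlow : Real.exp (weightSupport S hS x) ≤ K * n := by
    obtain ⟨χ, hχ, heq⟩ := Finset.exists_mem_eq_sup' hS
      fun χ : Fin N → ℤ => ∑ i, (χ i : ℝ) * x i
    have h := hcoeff (fun χ => ∏ i, ((d i : ℂ) ^ (χ.1 i))) ⟨χ, hχ⟩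
    rw [Finset.sum_coe_sort S fun χ => (∏ i, ((d i : ℂ) ^ (χ i))) • vc χ,
      norm_torus_character] at h
    rwa [weightSupport, heq]
  have hup : n ≤ Real.exp (weightSupport S hS x) * ∑ χ ∈ S, ‖vc χ‖ := by
    rw [Finset.mul_sum]
    refine norm_sum_le_of_le S fun χ hχ => ?_
    rw [norm_smul, norm_torus_character]
    gcongr
    exact Finset.le_sup' (fun χ : Fin N → ℤ => ∑ i, (χ i : ℝ) * x i) hχ
  have hn0 : 0 < n := pos_of_mul_pos_right ((Real.exp_pos _).trans_le hlow) hK.le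
  have h1 := Real.log_le_log (Real.exp_pos _) hlow
  have h2 := Real.log_le_log hn0 hup
  rw [Real.log_exp, Real.log_mul hK.ne' hn0.ne'] at h1
  rw [Real.log_mul (Real.exp_pos _).ne' hT.ne', Real.log_exp] at h2
  rw [abs_le]
  constructor
  · linarith [le_max_left (Real.log K) (Real.log (∑ χ ∈ S, ‖vc χ‖))]
  · linarith [le_max_right (Real.log K) (Real.log (∑ χ ∈ S, ‖vc χ‖))]

theorem exists_finset_support_of_sum_ne_zero {ι V : Type*} [AddCommMonoid V]
    (F : Finset ι) (vc : ι → V) (h : ∑ χ ∈ F, vc χ ≠ 0) :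
    ∃ S : Finset ι, (∀ χ, χ ∈ S ↔ χ ∈ F ∧ vc χ ≠ 0) ∧ S.Nonempty := by
  classical
  obtain ⟨χ, hχ, h0⟩ := Finset.exists_ne_zero_of_sum_ne_zero h
  exact ⟨F.filter fun χ => vc χ ≠ 0, fun χ => Finset.mem_filter,
    ⟨χ, Finset.mem_filter.2 ⟨hχ, h0⟩⟩⟩

/-- A difference of support functions is bounded below on `ℝᴺ` as soon as it is nonnegative on
`ℤᴺ`. -/
theorem exists_le_weightSupport_sub {N : ℕ} (S T : Finset (Fin N → ℤ)) (hS : S.Nonempty)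
    (hT : T.Nonempty) {α β : ℝ} (hα : 0 ≤ α) (hβ : 0 ≤ β)
    (h : ∀ lam : Fin N → ℤ, β * weightSupport T hT (fun i => (lam i : ℝ))
      ≤ α * weightSupport S hS (fun i => (lam i : ℝ))) :
    ∃ C : ℝ, ∀ x : Fin N → ℝ, C ≤ α * weightSupport S hS x - β * weightSupport T hT x := by
  refine ⟨-(α * ∑ χ ∈ S, ∑ i, |(χ i : ℝ)|) - β * ∑ χ ∈ T, ∑ i, |(χ i : ℝ)|, fun x => ?_⟩
  have hfl : ∀ i, |x i - (⌊x i⌋ : ℝ)| ≤ 1 := fun i => by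
    rw [Int.self_sub_floor, abs_of_nonneg (Int.fract_nonneg _)]
    exact (Int.fract_lt_one _).le
  have h1 := weightSupport_le_add S hS (fun i => (⌊x i⌋ : ℝ)) x
    fun i => by rw [abs_sub_comm]; exact hfl i
  have h2 := weightSupport_le_add T hT x (fun i => (⌊x i⌋ : ℝ)) hfl
  have h3 := mul_le_mul_of_nonneg_left h1 hα
  have h4 := mul_le_mul_of_nonneg_left h2 hβ
  linarith [h fun i => ⌊x i⌋]


/-- Torus case of Theorem 3.2(ii) of the paper (Boucksom–Hisamoto–Jonsson):
for weight decompositions `V = ⊕_{χ ∈ F} V_χ`, `W = ⊕_{χ ∈ G} W_χ` under the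
diagonal torus `(ℂ*)ᴺ` (acting by `d^χ = ∏ dᵢ^{χᵢ}`), nonzero vectors `v, w`
and reals `α, β > 0`, the function `f(d) = α log‖d·v‖ − β log‖d·w‖` is bounded
below on `(ℂ*)ᴺ` if and only if for every one-parameter subgroup `λ ∈ ℤᴺ`
one has `α·max_{χ ∈ M_v}⟨χ,λ⟩ ≥ β·max_{χ ∈ M_w}⟨χ,λ⟩`. -/
theorem torus_log_norm_bounded_below_iff_slopes_nonneg
    {V W : Type*}
    [NormedAddCommGroup V] [NormedSpace ℂ V] [FiniteDimensional ℂ V] [Nontrivial V]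
    [NormedAddCommGroup W] [NormedSpace ℂ W] [FiniteDimensional ℂ W] [Nontrivial W]
    (N : ℕ) (F G : Finset (Fin N → ℤ))
    (Vsub : (Fin N → ℤ) → Submodule ℂ V) (Wsub : (Fin N → ℤ) → Submodule ℂ W)
    (hVindep : iSupIndep fun χ : F => Vsub χ)
    (hVspan : (⨆ χ ∈ F, Vsub χ) = ⊤)
    (hWindep : iSupIndep fun χ : G => Wsub χ)
    (hWspan : (⨆ χ ∈ G, Wsub χ) = ⊤)
    (vc : (Fin N → ℤ) → V) (hvc : ∀ χ, vc χ ∈ Vsub χ)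
    (wc : (Fin N → ℤ) → W) (hwc : ∀ χ, wc χ ∈ Wsub χ)
    (v : V) (hv : v = ∑ χ ∈ F, vc χ) (hv0 : v ≠ 0)
    (w : W) (hw : w = ∑ χ ∈ G, wc χ) (hw0 : w ≠ 0)
    (α β : ℝ) (hα : 0 < α) (hβ : 0 < β) :
    (∃ C : ℝ, ∀ d : Fin N → ℂˣ,
        α * Real.log ‖∑ χ ∈ F, (∏ i, ((d i : ℂ) ^ (χ i))) • vc χ‖
          - β * Real.log ‖∑ χ ∈ G, (∏ i, ((d i : ℂ) ^ (χ i))) • wc χ‖ ≥ C)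
      ↔
    (∀ lam : Fin N → ℤ,
        α * sSup ((fun χ : Fin N → ℤ => ∑ i, (χ i : ℝ) * (lam i : ℝ)) ''
            {χ | χ ∈ F ∧ vc χ ≠ 0})
          ≥ β * sSup ((fun χ : Fin N → ℤ => ∑ i, (χ i : ℝ) * (lam i : ℝ)) ''
            {χ | χ ∈ G ∧ wc χ ≠ 0})) := by
  obtain ⟨S, hSF, hS⟩ := exists_finset_support_of_sum_ne_zero F vc (hv ▸ hv0)
  obtain ⟨T, hTG, hT⟩ := exists_finset_support_of_sum_ne_zero G wc (hw ▸ hw0)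
  obtain ⟨B, hB⟩ :=
    exists_abs_log_norm_torus_sub_weightSupport_le F Vsub hVindep vc hvc S hSF hS
  obtain ⟨D, hD⟩ :=
    exists_abs_log_norm_torus_sub_weightSupport_le G Wsub hWindep wc hwc T hTG hT
  have hSset : {χ | χ ∈ F ∧ vc χ ≠ 0} = (S : Set (Fin N → ℤ)) := by
    ext χ
    exact (hSF χ).symm
  have hTset : {χ | χ ∈ G ∧ wc χ ≠ 0} = (T : Set (Fin N → ℤ)) := by
    ext χ
    exact (hTG χ).symm
  simp only [hSset, hTset, ← Finset.sup'_eq_csSup_image _ hS, ← Finset.sup'_eq_csSup_image _ hT]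
  constructor
  · rintro ⟨C, hC⟩ lam
    change β * weightSupport T hT (fun i => (lam i : ℝ))
      ≤ α * weightSupport S hS (fun i => (lam i : ℝ))
    by_contra! hlt
    obtain ⟨n, hn⟩ := Archimedean.arch (α * B + β * D - C + 1) (sub_pos.2 hlt)
    rw [nsmul_eq_mul] at hn
    let d : Fin N → ℂˣ := fun i =>
      Units.mk0 (Complex.exp ((n * lam i : ℝ) : ℂ)) (Complex.exp_ne_zero _)
    have hd : (fun i => Real.log ‖(d i : ℂ)‖) = fun i => (n : ℝ) * (lam i : ℝ) := by
      funext i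
      simp only [d, Units.val_mk0, Complex.norm_exp, Complex.ofReal_re, Real.log_exp]
    have h1 := (abs_le.1 (hB d)).2
    have h2 := (abs_le.1 (hD d)).1
    rw [hd, weightSupport_smul _ _ _ n.cast_nonneg] at h1 h2
    have h3 := mul_le_mul_of_nonneg_left h1 hα.le
    have h4 := mul_le_mul_of_nonneg_left h2 hβ.le
    linarith [hC d]
  · intro h
    obtain ⟨C, hC⟩ := exists_le_weightSupport_sub S T hS hT hα.le hβ.le h
    refine ⟨C - α * B - β * D, fun d => ?_⟩
    have h3 := mul_le_mul_of_nonneg_left (abs_le.1 (hB d)).1 hα.le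
    have h4 := mul_le_mul_of_nonneg_left (abs_le.1 (hD d)).2 hβ.le
    linarith [hC fun i => Real.log ‖(d i : ℂ)‖]
end

section
/- Let S be a subset of a real vector space closed under scalar multiplication by every c ∈ (0,1], and let N, L, L₀, J : S → ℝ be functions and κ ≥ 0, C ≥ 0, δ > 0, B ∈ ℝ constants such that for all u ∈ S and all c ∈ (0,1]: (i) J(u) ≥ 0; (ii) N(c·u) = N(u) − κ·log c; (iii) L₀(c·u) = c·L₀(u); (iv) N(u) + L₀(u) ≥ B; (v) |L(u) − L₀(u)| ≤ C·J(u); (vi) L(u) ≥ δ·J(u). Then for every δ' with 0 < δ' < δ there exists a constant C' such that N(u) + L(u) ≥ δ'·J(u) − C' for all u ∈ S. -/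
/-- Quantitative core of "stability implies coercivity" (Section 2 of the paper):
if the nonlinear part `N` satisfies the scaling rule `N(c•u) = N(u) - κ log c`,
the reference linear part `L₀` is homogeneous, `N + L₀` is bounded below,
`|L - L₀| ≤ C·J`, and uniform stability `L ≥ δ·J` holds, then the K-energy
`M = N + L` is coercive with any coefficient `δ' < δ`. -/
theorem stability_to_coercivity_core
    {E : Type*} [AddCommGroup E] [Module ℝ E] (S : Set E)
    (hS : ∀ c : ℝ, c ∈ Set.Ioc (0 : ℝ) 1 → ∀ u ∈ S, c • u ∈ S)
    (N L L₀ J : E → ℝ) (κ C : ℝ) (hκ : 0 ≤ κ) (hC : 0 ≤ C)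
    (δ : ℝ) (hδ : 0 < δ) (B : ℝ)
    (hJ : ∀ u ∈ S, 0 ≤ J u)
    (hN : ∀ u ∈ S, ∀ c ∈ Set.Ioc (0 : ℝ) 1, N (c • u) = N u - κ * Real.log c)
    (hL₀ : ∀ u ∈ S, ∀ c ∈ Set.Ioc (0 : ℝ) 1, L₀ (c • u) = c * L₀ u)
    (hB : ∀ u ∈ S, B ≤ N u + L₀ u)
    (hcmp : ∀ u ∈ S, |L u - L₀ u| ≤ C * J u)
    (hstab : ∀ u ∈ S, δ * J u ≤ L u)
    (δ' : ℝ) (hδ'₀ : 0 < δ') (hδ'δ : δ' < δ) :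
    ∃ C' : ℝ, ∀ u ∈ S, N u + L u ≥ δ' * J u - C' := by
  have hδC : 0 < δ + C := by linarith
  obtain ⟨c, hc, hcδ⟩ : ∃ c ∈ Set.Ioc (0 : ℝ) 1, c * (δ + C) = δ - δ' :=
    ⟨(δ - δ') / (δ + C),
      ⟨div_pos (by linarith) hδC, (div_le_one hδC).2 (by linarith)⟩,
      div_mul_cancel₀ _ hδC.ne'⟩
  refine ⟨-(B + κ * Real.log c), fun u hu => ?_⟩
  have hBc := hB (c • u) (hS c hc u hu)
  rw [hN u hu c hc, hL₀ u hu c hc] at hBc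
  have hL₀_le : c * L₀ u ≤ c * (L u + C * J u) :=
    mul_le_mul_of_nonneg_left (by linarith [neg_le_of_abs_le (hcmp u hu)]) hc.1.le
  have hL_ge : (1 - c) * (δ * J u) ≤ (1 - c) * L u :=
    mul_le_mul_of_nonneg_left (hstab u hu) (sub_nonneg.2 hc.2)
  have hcJ : c * (δ + C) * J u = (δ - δ') * J u := by rw [hcδ]
  linarith
end

section
/- Suppose there exists δ > 0 such that L(f) ≥ δ·‖f‖_J for every function f : P → ℝ that is the maximum of finitely many affine functions with rational coefficients (a convex, rational piecewise-linear function). Then L(u) ≥ δ·‖u‖_J for every continuous convex function u : P → ℝ. -/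
open MeasureTheory
open scoped RealInnerProductSpace

/-- The toric J-norm of a function `f` on `P ⊂ ℝⁿ`:
`‖f‖_J = inf_ℓ ( (1/vol P) ∫_P (f+ℓ) dx − min_P (f+ℓ) )`, the infimum being
over all affine functions `ℓ : ℝⁿ → ℝ`. -/
noncomputable def Jnorm {n : ℕ} (P : Set (EuclideanSpace ℝ (Fin n)))
    (f : EuclideanSpace ℝ (Fin n) → ℝ) : ℝ :=
  ⨅ ℓ : EuclideanSpace ℝ (Fin n) →ᵃ[ℝ] ℝ,
    ((volume P).toReal⁻¹ * ∫ x in P, (f x + ℓ x))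
      - sInf ((fun x => f x + ℓ x) '' P)

/-- Donaldson's linear functional on the polytope `P` with boundary measure `σ`:
`L(f) = ∫_{∂P} f dσ − (σ(∂P)/vol P) ∫_P f dx`. -/
noncomputable def Ltoric {n : ℕ} (σ : Measure (EuclideanSpace ℝ (Fin n)))
    (P : Set (EuclideanSpace ℝ (Fin n))) (f : EuclideanSpace ℝ (Fin n) → ℝ) : ℝ :=
  (∫ x, f x ∂σ) - ((σ Set.univ).toReal / (volume P).toReal) * ∫ x in P, f x

/-- `f` is a convex, rational piecewise-linear function: the maximum of finitely
many affine functions with rational coefficients. -/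
def IsConvexRationalPL {n : ℕ} (f : EuclideanSpace ℝ (Fin n) → ℝ) : Prop :=
  ∃ (m : ℕ) (hm : 0 < m) (q : Fin m → Fin n → ℚ) (c : Fin m → ℚ),
    ∀ x, f x = Finset.univ.sup'
      (Finset.univ_nonempty_iff.mpr (Fin.pos_iff_nonempty.mp hm))
      (fun i => (∑ j, (q i j : ℝ) * x j) + (c i : ℝ))

/-- On a bounded set, a continuous affine function can be uniformly approximated by affine
functions with rational coefficients. -/
theorem exists_rational_affine_near {n : ℕ} {K : Set (EuclideanSpace ℝ (Fin n))}
    (hK : Bornology.IsBounded K) (l : EuclideanSpace ℝ (Fin n) →L[ℝ] ℝ) (c : ℝ)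
    {ε : ℝ} (hε : 0 < ε) :
    ∃ (q : Fin n → ℚ) (r : ℚ),
      ∀ x ∈ K, |l x + c - ((∑ j, (q j : ℝ) * x j) + (r : ℝ))| < ε := by
  obtain ⟨R, hR0, hR⟩ := hK.exists_pos_norm_le
  have hη : 0 < ε / (2 * (n + 1) * R) := by positivity
  choose q hq using fun j : Fin n => exists_rat_near (l (EuclideanSpace.single j 1)) hη
  obtain ⟨r, hr⟩ := exists_rat_near c (half_pos hε)
  refine ⟨q, r, fun x hx => ?_⟩
  have hl : l x = ∑ j, l (EuclideanSpace.single j 1) * x j := by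
    conv_lhs => rw [← (EuclideanSpace.basisFun (Fin n) ℝ).sum_repr x]
    simp [map_sum, mul_comm]
  have hsum : |∑ j, (l (EuclideanSpace.single j 1) - q j) * x j| ≤ ε / 2 := by
    calc |∑ j, (l (EuclideanSpace.single j 1) - q j) * x j|
        ≤ ∑ j, |(l (EuclideanSpace.single j 1) - q j) * x j| := Finset.abs_sum_le_sum_abs _ _
      _ ≤ ∑ _j : Fin n, ε / (2 * (n + 1) * R) * R := by
          refine Finset.sum_le_sum fun j _ => ?_
          rw [abs_mul]
          exact mul_le_mul (hq j).le ((PiLp.norm_apply_le x j).trans (hR x hx))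
            (abs_nonneg _) hη.le
      _ = n / (n + 1) * (ε / 2) := by
          simp only [Finset.sum_const, Finset.card_univ, Fintype.card_fin, nsmul_eq_mul]
          field_simp
      _ ≤ ε / 2 := by
          refine mul_le_of_le_one_left (half_pos hε).le ?_
          rw [div_le_one (by positivity)]
          linarith
  have heq : l x + c - ((∑ j, (q j : ℝ) * x j) + (r : ℝ))
      = (∑ j, (l (EuclideanSpace.single j 1) - q j) * x j) + (c - r) := by
    rw [hl]
    simp only [sub_mul, Finset.sum_sub_distrib]
    ring
  rw [heq]
  linarith [abs_add_le (∑ j, (l (EuclideanSpace.single j 1) - q j) * x j) (c - r)]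

theorem IsConvexRationalPL.continuous {n : ℕ} {f : EuclideanSpace ℝ (Fin n) → ℝ}
    (hf : IsConvexRationalPL f) : Continuous f := by
  obtain ⟨m, hm, q, c, hf⟩ := hf
  rw [funext hf]
  exact Continuous.finset_sup'_apply _ fun i _ => by fun_prop

/-- A continuous convex function on a nonempty compact convex set is a uniform limit of convex
rational piecewise-linear functions. -/
theorem exists_isConvexRationalPL_near {n : ℕ} {K : Set (EuclideanSpace ℝ (Fin n))}
    (hK : IsCompact K) (hne : K.Nonempty) {u : EuclideanSpace ℝ (Fin n) → ℝ}
    (hu : ContinuousOn u K) (hconv : ConvexOn ℝ K u) {ε : ℝ} (hε : 0 < ε) :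
    ∃ f, IsConvexRationalPL f ∧ ∀ x ∈ K, |u x - f x| ≤ ε := by
  have key : ∀ x ∈ K, ∃ (q : Fin n → ℚ) (r : ℚ),
      (∀ y ∈ K, (∑ j, (q j : ℝ) * y j) + (r : ℝ) ≤ u y + ε) ∧
      u x - ε < (∑ j, (q j : ℝ) * x j) + (r : ℝ) := by
    intro x hx
    obtain ⟨l, c, hle, heq⟩ := ConvexOn.exists_affine_le_of_lt (𝕜 := ℝ) hx
      (show u x - ε / 2 < u x by linarith) hK.isClosed hu.lowerSemicontinuousOn hconv
    obtain ⟨q, r, hqr⟩ := exists_rational_affine_near hK.isBounded l c (half_pos hε)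
    refine ⟨q, r, fun y hy => ?_, ?_⟩
    · have h1 : l y + c ≤ u y := by simpa using hle ⟨y, hy⟩
      linarith [(abs_lt.mp (hqr y hy)).1]
    · have h1 : l x + c = u x - ε / 2 := by simpa using heq
      linarith [(abs_lt.mp (hqr x hx)).2]
  choose! q r hle hlt using key
  obtain ⟨t, htK, ht⟩ := hK.elim_nhdsWithin_subcover
    (fun x => {y | u y - ε < (∑ j, (q x j : ℝ) * y j) + (r x : ℝ)}) fun x hx => by
      have hcont : ContinuousWithinAt (fun y : EuclideanSpace ℝ (Fin n) =>
          (∑ j, (q x j : ℝ) * y j) + (r x : ℝ)) K x :=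
        Continuous.continuousWithinAt (by fun_prop)
      exact ((hu x hx).sub continuousWithinAt_const).eventually_lt hcont (hlt x hx)
  have htpos : 0 < t.card := by
    obtain ⟨x, hx⟩ := hne
    obtain ⟨z, hz, -⟩ := Set.mem_iUnion₂.mp (ht hx)
    exact Finset.card_pos.mpr ⟨z, hz⟩
  let e := t.equivFin.symm
  refine ⟨_, ⟨t.card, htpos, fun i => q (e i), fun i => r (e i), fun _ => rfl⟩, fun x hx => ?_⟩
  rw [abs_le]
  constructor
  · rw [neg_le_sub_iff_le_add]
    exact Finset.sup'_le _ _ fun i _ => hle _ (htK _ (e i).2) x hx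
  · obtain ⟨z, hz, hzx⟩ := Set.mem_iUnion₂.mp (ht hx)
    have h := Finset.le_sup' (fun i => (∑ j, (q (e i) j : ℝ) * x j) + (r (e i) : ℝ))
      (Finset.mem_univ (e.symm ⟨z, hz⟩))
    simp only [Equiv.apply_symm_apply] at h
    have hzx' : u x - ε < (∑ j, (q z j : ℝ) * x j) + (r z : ℝ) := hzx
    linarith

/-- The infimum of a continuous function over a compact set is at most its mean. -/
theorem sInf_image_le_setAverage {n : ℕ} {P : Set (EuclideanSpace ℝ (Fin n))}
    (hP : IsCompact P) (hvol : 0 < (volume P).toReal)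
    {g : EuclideanSpace ℝ (Fin n) → ℝ} (hg : ContinuousOn g P) :
    sInf (g '' P) ≤ (volume P).toReal⁻¹ * ∫ x in P, g x := by
  have hbdd : BddBelow (g '' P) := (hP.image_of_continuousOn hg).bddBelow
  rw [inv_mul_eq_div, le_div_iff₀ hvol]
  have h := setIntegral_mono_on (integrableOn_const (μ := volume) (C := sInf (g '' P)) hP.measure_lt_top.ne)
    (hg.integrableOn_compact hP) hP.measurableSet
    fun x hx => csInf_le hbdd (Set.mem_image_of_mem g hx)
  simpa [Measure.real, mul_comm] using h

/-- The integrals of two continuous functions that differ by at most `ε` on a compact set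
carrying the measure differ by at most `ε` times the total mass. -/
theorem integral_sub_integral_le {n : ℕ} {P : Set (EuclideanSpace ℝ (Fin n))}
    (hP : IsCompact P) (μ : Measure (EuclideanSpace ℝ (Fin n))) [IsFiniteMeasure μ]
    (hμ : μ.restrict P = μ) {u v : EuclideanSpace ℝ (Fin n) → ℝ} (hu : ContinuousOn u P)
    (hv : ContinuousOn v P) {ε : ℝ} (huv : ∀ x ∈ P, |u x - v x| ≤ ε) :
    |(∫ x, u x ∂μ) - ∫ x, v x ∂μ| ≤ ε * (μ Set.univ).toReal := by
  have hiu : Integrable u μ := by rw [← hμ]; exact hu.integrableOn_compact hP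
  have hiv : Integrable v μ := by rw [← hμ]; exact hv.integrableOn_compact hP
  rw [← integral_sub hiu hiv]
  refine norm_integral_le_of_norm_le_const (μ := μ) (f := fun x => u x - v x) ?_
  rw [← hμ]
  exact ae_restrict_of_forall_mem hP.measurableSet huv

theorem Jnorm_le_add {n : ℕ} {P : Set (EuclideanSpace ℝ (Fin n))}
    (hP : IsCompact P) (hvol : 0 < (volume P).toReal)
    {u v : EuclideanSpace ℝ (Fin n) → ℝ} (hu : ContinuousOn u P)
    (hv : ContinuousOn v P) {ε : ℝ} (huv : ∀ x ∈ P, |u x - v x| ≤ ε) :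
    Jnorm P u ≤ Jnorm P v + 2 * ε := by
  have hne : P.Nonempty := by
    rw [Set.nonempty_iff_ne_empty]
    rintro rfl
    simp at hvol
  have hℓ (ℓ : EuclideanSpace ℝ (Fin n) →ᵃ[ℝ] ℝ) : ContinuousOn ℓ P :=
    ℓ.continuous_of_finiteDimensional.continuousOn
  rw [← sub_le_iff_le_add]
  refine le_ciInf fun ℓ => ?_
  have hbdd : BddBelow (Set.range fun ℓ : EuclideanSpace ℝ (Fin n) →ᵃ[ℝ] ℝ =>
      ((volume P).toReal⁻¹ * ∫ x in P, (u x + ℓ x)) - sInf ((fun x => u x + ℓ x) '' P)) := by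
    refine ⟨0, ?_⟩
    rintro _ ⟨ℓ, rfl⟩
    exact sub_nonneg.mpr (sInf_image_le_setAverage hP hvol (hu.add (hℓ ℓ)))
  have hterm : Jnorm P u ≤ ((volume P).toReal⁻¹ * ∫ x in P, (u x + ℓ x))
      - sInf ((fun x => u x + ℓ x) '' P) := ciInf_le hbdd ℓ
  have : IsFiniteMeasure (volume.restrict P) := ⟨by simpa using hP.measure_lt_top⟩
  have hint := integral_sub_integral_le hP (volume.restrict P)
    (Measure.restrict_restrict_of_subset subset_rfl) (hu.add (hℓ ℓ)) (hv.add (hℓ ℓ))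
    (ε := ε) (fun x hx => by simpa using huv x hx)
  simp only [Pi.add_apply, Measure.restrict_apply_univ] at hint
  have havg : (volume P).toReal⁻¹ * (∫ x in P, (u x + ℓ x))
      ≤ (volume P).toReal⁻¹ * (∫ x in P, (v x + ℓ x)) + ε := by
    rw [inv_mul_eq_div, inv_mul_eq_div, div_le_iff₀ hvol, add_mul, div_mul_cancel₀ _ hvol.ne']
    linarith [(abs_le.mp hint).2]
  have hinf : sInf ((fun x => v x + ℓ x) '' P) - ε ≤ sInf ((fun x => u x + ℓ x) '' P) := by
    refine le_csInf (hne.image _) ?_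
    rintro _ ⟨x, hx, rfl⟩
    have h := csInf_le (hP.image_of_continuousOn (hv.add (hℓ ℓ))).bddBelow
      (Set.mem_image_of_mem _ hx)
    simp only [Pi.add_apply] at h
    change sInf ((fun x => v x + ℓ x) '' P) ≤ _ at h
    linarith [(abs_le.mp (huv x hx)).1]
  linarith

theorem Ltoric_le_add {n : ℕ} {P : Set (EuclideanSpace ℝ (Fin n))}
    (hP : IsCompact P) (hvol : 0 < (volume P).toReal)
    (σ : Measure (EuclideanSpace ℝ (Fin n))) [IsFiniteMeasure σ] (hσ : σ.restrict P = σ)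
    {u v : EuclideanSpace ℝ (Fin n) → ℝ} (hu : ContinuousOn u P)
    (hv : ContinuousOn v P) {ε : ℝ} (huv : ∀ x ∈ P, |u x - v x| ≤ ε) :
    Ltoric σ P v ≤ Ltoric σ P u + 2 * (σ Set.univ).toReal * ε := by
  have : IsFiniteMeasure (volume.restrict P) := ⟨by simpa using hP.measure_lt_top⟩
  have h1 := integral_sub_integral_le hP σ hσ hu hv huv
  have h2 := integral_sub_integral_le hP (volume.restrict P)
    (Measure.restrict_restrict_of_subset subset_rfl) hu hv huv
  rw [Measure.restrict_apply_univ] at h2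
  have h3 : (σ Set.univ).toReal / (volume P).toReal * ((∫ x in P, u x) - ∫ x in P, v x)
      ≤ (σ Set.univ).toReal * ε := by
    calc _ ≤ (σ Set.univ).toReal / (volume P).toReal * (ε * (volume P).toReal) := by
          gcongr
          exact (abs_le.mp h2).2
      _ = _ := by field_simp
  rw [mul_sub] at h3
  unfold Ltoric
  linarith [(abs_le.mp h1).1]

/-- The approximation step in Section 2 of the paper (following Donaldson):
uniform K-stability tested on convex rational piecewise-linear functions
extends to all continuous convex functions on `P`. -/
theorem uniform_stability_extends_to_continuous_convex
    {n d : ℕ} (P : Set (EuclideanSpace ℝ (Fin n)))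
    (hPc : IsCompact P) (hPconv : Convex ℝ P) (hPint : (interior P).Nonempty)
    (α : Fin d → EuclideanSpace ℝ (Fin n)) (β : Fin d → ℝ)
    (hα : ∀ k, α k ≠ 0)
    (hP : P = {x | ∀ k, 0 ≤ ⟪x, α k⟫ - β k})
    (Fk : Fin d → Set (EuclideanSpace ℝ (Fin n)))
    (hFk : ∀ k, Fk k = P ∩ {x | ⟪x, α k⟫ = β k})
    (hFacet : ∀ k, 0 < μH[((n : ℝ) - 1)] (Fk k) ∧ μH[((n : ℝ) - 1)] (Fk k) < ⊤)
    (σ : Measure (EuclideanSpace ℝ (Fin n)))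
    (hσ : σ = ∑ k : Fin d,
      (ENNReal.ofReal ‖α k‖⁻¹) • (μH[((n : ℝ) - 1)]).restrict (Fk k))
    (δ : ℝ) (hδ : 0 < δ)
    (hstab : ∀ f : EuclideanSpace ℝ (Fin n) → ℝ,
      IsConvexRationalPL f → Ltoric σ P f ≥ δ * Jnorm P f) :
    ∀ u : EuclideanSpace ℝ (Fin n) → ℝ, ContinuousOn u P → ConvexOn ℝ P u →
      Ltoric σ P u ≥ δ * Jnorm P u := by
  intro u hu hconv
  have hvolpos : 0 < volume P := hPint.elim fun x hx =>
    (isOpen_interior.measure_pos volume ⟨x, hx⟩).trans_le (measure_mono interior_subset)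
  have hvol : 0 < (volume P).toReal := ENNReal.toReal_pos hvolpos.ne' hPc.measure_lt_top.ne
  have hFP : ∀ k, Fk k ⊆ P := fun k => hFk k ▸ Set.inter_subset_left
  have hfin : IsFiniteMeasure σ := by
    refine ⟨?_⟩
    rw [hσ]
    simp only [Measure.coe_finsetSum, Finset.sum_apply, Measure.smul_apply,
      Measure.restrict_apply_univ, smul_eq_mul]
    exact ENNReal.sum_lt_top.mpr fun k _ => ENNReal.mul_lt_top ENNReal.ofReal_lt_top (hFacet k).2
  have hσP : σ.restrict P = σ := by
    refine Measure.restrict_eq_self_of_ae_mem ?_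
    rw [ae_iff, hσ]
    simp only [Measure.coe_finsetSum, Finset.sum_apply, Measure.smul_apply, smul_eq_mul]
    refine Finset.sum_eq_zero fun k _ => mul_eq_zero_of_right _ ?_
    change (μH[((n : ℝ) - 1)]).restrict (Fk k) Pᶜ = 0
    rw [Measure.restrict_apply hPc.measurableSet.compl]
    convert measure_empty (μ := μH[((n : ℝ) - 1)])
    exact (Set.disjoint_compl_left_iff_subset.mpr (hFP k)).inter_eq
  have hbound : ∀ ε > 0,
      δ * Jnorm P u ≤ Ltoric σ P u + (2 * (σ Set.univ).toReal + 2 * δ) * ε := by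
    intro ε hε
    obtain ⟨f, hf, huf⟩ :=
      exists_isConvexRationalPL_near hPc (hPint.mono interior_subset) hu hconv hε
    have hfc : ContinuousOn f P := hf.continuous.continuousOn
    have hJ := mul_le_mul_of_nonneg_left (Jnorm_le_add hPc hvol hu hfc huf) hδ.le
    have hL := Ltoric_le_add hPc hvol σ hσP hu hfc huf
    linarith [hstab f hf]
  refine le_of_forall_pos_le_add fun η hη => ?_
  have hC : 0 < 2 * (σ Set.univ).toReal + 2 * δ := by positivity
  simpa [mul_div_cancel₀ _ hC.ne'] using hbound _ (div_pos hη hC)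
end
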